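/- Let V be a 2-generated primitive axial algebra of Monster type (2β, β) over a field F of characteristic ≠ 2 (β ∉ {0, 1, 1/2}) with generating axes a₀, a₁, and suppose V is symmetric (some algebra automorphism of V interchanges a₀ and a₁) and dim_F V ≤ 3. Then one of the following holds: (i) V_{2β}^{a₀} = V_{2β}^{a₁} = 0 (V is of Jordan type β); (ii) V_β^{a₀} = V_β^{a₁} = 0 (V is of Jordan type 2β); (iii) 18β² − β − 1 = 0 in F and V is isomorphic as an F-algebra to V₃(β). -/

import Mathlib

/-- The `δ`-eigenspace of the adjoint action of `a` on `V`. -/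
def eigSp (F : Type*) [Field F] {V : Type*} [NonUnitalNonAssocCommRing V]
    [Module F V] [SMulCommClass F V V] [IsScalarTower F V V]
    (a : V) (δ : F) : Submodule F V where
  carrier := {v | a * v = δ • v}
  add_mem' := by
    intro x y hx hy
    simp only [Set.mem_setOf_eq] at *
    rw [mul_add, hx, hy, smul_add]
  zero_mem' := by
    simp
  smul_mem' := by
    intro c x hx
    simp only [Set.mem_setOf_eq] at *
    rw [mul_smul_comm, hx, smul_comm]

/-- `a` is a primitive axis of Monster type `(α, β)`:  `a` is idempotent, `V` decomposes as the
sum of the eigenspaces of `ad a` for the eigenvalues `1, 0, α, β`, the fusion law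
M(α, β) holds, and the `1`-eigenspace is spanned by `a` (primitivity). -/
structure IsAxis (F : Type*) [Field F] {V : Type*} [NonUnitalNonAssocCommRing V]
    [Module F V] [SMulCommClass F V V] [IsScalarTower F V V]
    (α β : F) (a : V) : Prop where
  idem : a * a = a
  semisimple : eigSp F a 1 ⊔ eigSp F a 0 ⊔ eigSp F a α ⊔ eigSp F a β = ⊤
  primitive : eigSp F a 1 = Submodule.span F {a}
  fusion11 : ∀ u ∈ eigSp F a 1, ∀ v ∈ eigSp F a 1, u * v ∈ eigSp F a 1
  fusion10 : ∀ u ∈ eigSp F a 1, ∀ v ∈ eigSp F a 0, u * v = 0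
  fusion1a : ∀ u ∈ eigSp F a 1, ∀ v ∈ eigSp F a α, u * v ∈ eigSp F a α
  fusion1b : ∀ u ∈ eigSp F a 1, ∀ v ∈ eigSp F a β, u * v ∈ eigSp F a β
  fusion00 : ∀ u ∈ eigSp F a 0, ∀ v ∈ eigSp F a 0, u * v ∈ eigSp F a 0
  fusion0a : ∀ u ∈ eigSp F a 0, ∀ v ∈ eigSp F a α, u * v ∈ eigSp F a α
  fusion0b : ∀ u ∈ eigSp F a 0, ∀ v ∈ eigSp F a β, u * v ∈ eigSp F a β
  fusionaa : ∀ u ∈ eigSp F a α, ∀ v ∈ eigSp F a α, u * v ∈ eigSp F a 1 ⊔ eigSp F a 0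
  fusionab : ∀ u ∈ eigSp F a α, ∀ v ∈ eigSp F a β, u * v ∈ eigSp F a β
  fusionbb : ∀ u ∈ eigSp F a β, ∀ v ∈ eigSp F a β,
    u * v ∈ eigSp F a 1 ⊔ eigSp F a 0 ⊔ eigSp F a α

/-- `g` is an (algebra) automorphism of `V`:  a linear automorphism preserving products. -/
def IsAlgAut (F : Type*) [Field F] {V : Type*} [NonUnitalNonAssocCommRing V]
    [Module F V] [SMulCommClass F V V] [IsScalarTower F V V]
    (g : V ≃ₗ[F] V) : Prop :=
  ∀ x y : V, g (x * y) = g x * g y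

/-- Nonzero eigenvectors for the distinct eigenvalues `1, 2β, β` are independent. -/
theorem linearIndependent_eigenvectors {F V : Type*} [Field F]
    [NonUnitalNonAssocCommRing V] [Module F V] [SMulCommClass F V V] {β : F} (hβ0 : β ≠ 0) (hβ1 : β ≠ 1)
    (hβ2 : 1 - 2 * β ≠ 0) {a u v : V} (ha0 : a ≠ 0) (hu0 : u ≠ 0) (hv0 : v ≠ 0)
    (ha : a * a = a) (hu : a * u = (2 * β) • u) (hv : a * v = β • v) :
    LinearIndependent F ![a, u, v] := by
  rw [Fintype.linearIndependent_iff]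
  intro c hc
  simp only [Fin.sum_univ_three, Matrix.cons_val_zero, Matrix.cons_val_one,
    Matrix.cons_val] at hc
  have h1 := congrArg (a * ·) hc
  simp only [mul_add, mul_smul_comm, ha, hu, hv, mul_zero] at h1
  have h2 := congrArg (a * ·) h1
  simp only [mul_add, mul_smul_comm, ha, hu, hv, mul_zero] at h2
  have e0 : ((1 - β) * (1 - 2 * β) * c 0) • a = 0 := by
    linear_combination (norm := module) h2 - (3 * β) • h1 + (2 * β ^ 2) • hc
  have hβ1' : 1 - β ≠ 0 := sub_ne_zero.2 hβ1.symm
  have c0 : c 0 = 0 := by simpa [ha0, hβ1', hβ2] using e0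
  simp only [c0, zero_smul, zero_add] at hc h1
  have e1 : (β * c 1) • u = 0 := by
    linear_combination (norm := module) h1 - β • hc
  have c1 : c 1 = 0 := by simpa [hu0, hβ0] using e1
  have c2 : c 2 = 0 := by simpa [c1, hv0] using hc
  intro i
  fin_cases i <;> assumption

theorem LinearIndependent.coeff_eq_zero {F V : Type*} [Field F] [AddCommGroup V] [Module F V]
    {a u v : V} (h : LinearIndependent F ![a, u, v]) {x y z : F}
    (hxyz : x • a + y • u + z • v = 0) : x = 0 ∧ y = 0 ∧ z = 0 := by
  have := Fintype.linearIndependent_iff.1 h ![x, y, z]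
    (by simpa [Fin.sum_univ_three] using hxyz)
  exact ⟨this 0, this 1, this 2⟩

theorem LinearIndependent.exists_coeff {F V : Type*} [Field F] [AddCommGroup V] [Module F V]
    [Module.Finite F V] (hdim : Module.finrank F V ≤ 3) {a u v : V}
    (h : LinearIndependent F ![a, u, v]) (w : V) : ∃ x y z : F, w = x • a + y • u + z • v := by
  have hr : Fintype.card (Fin 3) = Module.finrank F V :=
    le_antisymm h.fintype_card_le_finrank (by simpa using hdim)
  have hs := h.span_eq_top_of_card_eq_finrank' hr
  have hw : w ∈ Submodule.span F (Set.range ![a, u, v]) := hs ▸ Submodule.mem_top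
  obtain ⟨c, hc⟩ := (Submodule.mem_span_range_iff_exists_fun F).1 hw
  exact ⟨c 0, c 1, c 2, by simpa [Fin.sum_univ_three] using hc.symm⟩

section

variable {F V : Type*} [Field F] [NonUnitalNonAssocCommRing V]
  [Module F V] [SMulCommClass F V V] [IsScalarTower F V V]

theorem mem_eigSp {a v : V} {δ : F} : v ∈ eigSp F a δ ↔ a * v = δ • v := Iff.rfl

/-- An automorphism carries eigenspaces of `a` to eigenspaces of the image of `a`. -/
theorem IsAlgAut.map_mem_eigSp {g : V ≃ₗ[F] V} (hg : IsAlgAut F g) {a v : V} {δ : F}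
    (hv : v ∈ eigSp F a δ) : g v ∈ eigSp F (g a) δ := by
  rw [mem_eigSp] at *
  rw [← hg, hv, map_smul]

theorem IsAlgAut.eigSp_eq_bot {g : V ≃ₗ[F] V} (hg : IsAlgAut F g) {a b : V} {δ : F}
    (hb : g b = a) (h : eigSp F a δ = ⊥) : eigSp F b δ = ⊥ := by
  rw [Submodule.eq_bot_iff] at *
  intro v hv
  have := h (g v) (hb ▸ hg.map_mem_eigSp hv)
  simpa using this

/-- A submodule closed under multiplication which contains a generating set is everything. -/
theorem Submodule.eq_top_of_adjoin_eq_top {s : Set V} (hs : NonUnitalAlgebra.adjoin F s = ⊤)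
    (W : Submodule F V) (hW : ∀ x ∈ W, ∀ y ∈ W, x * y ∈ W) (hsW : s ⊆ W) : W = ⊤ := by
  let S : NonUnitalSubalgebra F V :=
    { W with mul_mem' := fun {x y} hx hy => hW x hx y hy }
  have hS : NonUnitalAlgebra.adjoin F s ≤ S := NonUnitalAlgebra.adjoin_le hsW
  rw [hs] at hS
  exact eq_top_iff.2 fun x _ => hS (NonUnitalAlgebra.mem_top (R := F))

theorem span_pair_mul_mem {a w : V} (haa : a * a ∈ Submodule.span F {a, w})
    (haw : a * w ∈ Submodule.span F {a, w}) (hww : w * w ∈ Submodule.span F {a, w}) :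
    ∀ x ∈ Submodule.span F {a, w}, ∀ y ∈ Submodule.span F {a, w},
      x * y ∈ Submodule.span F {a, w} := by
  intro x hx y hy
  obtain ⟨x₁, x₂, rfl⟩ := Submodule.mem_span_pair.1 hx
  obtain ⟨y₁, y₂, rfl⟩ := Submodule.mem_span_pair.1 hy
  have h : (x₁ • a + x₂ • w) * (y₁ • a + y₂ • w)
      = (x₁ * y₁) • (a * a) + (x₁ * y₂ + x₂ * y₁) • (a * w) + (x₂ * y₂) • (w * w) := by
    simp only [add_mul, mul_add, smul_mul_assoc, mul_smul_comm, mul_comm w a]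
    module
  rw [h]
  exact add_mem (add_mem (Submodule.smul_mem _ _ haa) (Submodule.smul_mem _ _ haw))
    (Submodule.smul_mem _ _ hww)

/-- If `1, 2β, β` all occur as eigenvalues on an algebra of dimension at most `3`, then the
products of the eigenvectors are forced up to scalars. -/
theorem IsAxis.mul_eigenvectors [Module.Finite F V] (hdim : Module.finrank F V ≤ 3) {β : F}
    (h2 : (2 : F) ≠ 0) (hβ0 : β ≠ 0) (hβ1 : β ≠ 1) {a u v : V} (ha : IsAxis F (2 * β) β a)
    (hind : LinearIndependent F ![a, u, v])
    (hu : a * u = (2 * β) • u) (hv : a * v = β • v) :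
    (∃ s : F, u * u = s • a) ∧ (∃ t : F, u * v = t • v) ∧
      ∃ y z : F, v * v = y • a + z • u := by
  have hmul : ∀ x y z : F, a * (x • a + y • u + z • v)
      = x • a + (2 * β * y) • u + (β * z) • v := by
    intro x y z
    simp only [mul_add, mul_smul_comm, ha.idem, hu, hv]
    module
  have h0 : ∀ w ∈ eigSp F a 0, w = 0 := by
    intro w hw
    obtain ⟨x, y, z, rfl⟩ := hind.exists_coeff hdim w
    rw [mem_eigSp, hmul, zero_smul] at hw
    obtain ⟨rfl, hy, hz⟩ := hind.coeff_eq_zero hw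
    have hy : y = 0 := by simpa [h2, hβ0] using hy
    have hz : z = 0 := by simpa [hβ0] using hz
    simp [hy, hz]
  have h1 : ∀ w ∈ eigSp F a 1 ⊔ eigSp F a 0, ∃ s : F, w = s • a := by
    intro w hw
    obtain ⟨w₁, hw₁, w₀, hw₀, rfl⟩ := Submodule.mem_sup.1 hw
    rw [ha.primitive, Submodule.mem_span_singleton] at hw₁
    obtain ⟨s, rfl⟩ := hw₁
    exact ⟨s, by rw [h0 _ hw₀, add_zero]⟩
  refine ⟨h1 _ (ha.fusionaa u hu u hu), ?_, ?_⟩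
  · have huv := ha.fusionab u hu v hv
    obtain ⟨x, y, z, h⟩ := hind.exists_coeff hdim (u * v)
    rw [h, mem_eigSp, hmul] at huv
    have e : ((1 - β) * x) • a + (β * y) • u + (0 : F) • v = 0 := by
      linear_combination (norm := module) huv
    have hβ1' : 1 - β ≠ 0 := sub_ne_zero.2 hβ1.symm
    obtain ⟨ex, ey, -⟩ := hind.coeff_eq_zero e
    have hx : x = 0 := by simpa [hβ1'] using ex
    have hy : y = 0 := by simpa [hβ0] using ey
    exact ⟨z, by simp [h, hx, hy]⟩
  · obtain ⟨w, hw, w', hw', h⟩ := Submodule.mem_sup.1 (ha.fusionbb v hv v hv)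
    obtain ⟨s, rfl⟩ := h1 w hw
    obtain ⟨x, y, z, rfl⟩ := hind.exists_coeff hdim w'
    rw [mem_eigSp, hmul] at hw'
    have e : ((1 - 2 * β) * x) • a + (0 : F) • u + (-(β * z)) • v = 0 := by
      linear_combination (norm := module) hw'
    have hz : z = 0 := by simpa [hβ0] using (hind.coeff_eq_zero e).2.2
    refine ⟨s + x, y, ?_⟩
    rw [← h, hz]
    module

/-- The multiplication of `V` in a basis of eigenvectors of one axis, together with the axis
condition for a second one, forces the structure constants of `V₃(β)`. -/
theorem structure_constants {β : F} (h2 : (2 : F) ≠ 0) (hβ0 : β ≠ 0) (hβ2 : 1 - 2 * β ≠ 0)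
    {a b p q : V} {x s t y z : F} (hind : LinearIndependent F ![a, p, q])
    (haa : a * a = a) (hap : a * p = (2 * β) • p) (haq : a * q = β • q)
    (hpp : p * p = s • a) (hpq : p * q = t • q) (hqq : q * q = y • a + z • p)
    (hb : b = x • a + p + q) (hbb : b * b = b)
    (hsym : ∃ r : V, b * r = β • r ∧ β • r = (2 * β) • (a - x • b) - (a * b - x • b)) :
    18 * β ^ 2 - β - 1 = 0 ∧ 4 * x = 9 * β + 1 ∧ 2 * (x * (1 - 2 * β)) = 3 * β ∧
      4 * s = 2 * x - 4 * x ^ 2 + 6 * β * x + β ∧ y = x - x ^ 2 - s ∧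
      z = 1 - 4 * x * β ∧ t = 1 / 2 - x * β := by
  have hmul : ∀ A B C : F, b * (A • a + B • p + C • q)
      = (A * x + B * s + C * y) • a + (2 * β * A + 2 * β * x * B + C * z) • p
        + (β * A + t * B + (x * β + t) * C) • q := by
    intro A B C
    simp only [hb, mul_add, add_mul, mul_smul_comm, smul_mul_assoc, haa, hap, haq, hpp, hpq, hqq,
      mul_comm p a, mul_comm q a, mul_comm q p]
    module
  have e : (x * x + s + y - x) • a + (4 * x * β + z - 1) • p + (2 * x * β + 2 * t - 1) • q = 0 := by
    have h := hmul x 1 1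
    rw [one_smul, one_smul, ← hb, hbb, hb] at h
    linear_combination (norm := module) -h
  obtain ⟨hy, hz, ht⟩ := hind.coeff_eq_zero e
  have hy : y = x - x ^ 2 - s := by linear_combination hy
  have hz : z = 1 - 4 * x * β := by linear_combination hz
  have ht : t = 1 / 2 - x * β := by field_simp; linear_combination ht
  obtain ⟨r, hr, hr'⟩ := hsym
  have hr'' : β • r = (2 * β - x + x ^ 2 * (1 - 2 * β)) • a + (-(2 * β) + x * (1 - 2 * β)) • p
      + (-β + x * (1 - 2 * β)) • q := by
    rw [hr', hb]
    simp only [mul_add, mul_smul_comm, haa, hap, haq]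
    module
  have h : b * (β • r) = β • (β • r) := by rw [mul_smul_comm, hr]
  rw [hr'', hmul] at h
  have e' : ((2 * β - x + x ^ 2 * (1 - 2 * β)) * x + (-(2 * β) + x * (1 - 2 * β)) * s
        + (-β + x * (1 - 2 * β)) * y - β * (2 * β - x + x ^ 2 * (1 - 2 * β))) • a
      + (2 * β * (2 * β - x + x ^ 2 * (1 - 2 * β)) + 2 * β * x * (-(2 * β) + x * (1 - 2 * β))
        + (-β + x * (1 - 2 * β)) * z - β * (-(2 * β) + x * (1 - 2 * β))) • p
      + (β * (2 * β - x + x ^ 2 * (1 - 2 * β)) + t * (-(2 * β) + x * (1 - 2 * β))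
        + (x * β + t) * (-β + x * (1 - 2 * β)) - β * (-β + x * (1 - 2 * β))) • q = 0 := by
    linear_combination (norm := module) h
  obtain ⟨ea, ep, eq⟩ := hind.coeff_eq_zero e'
  subst hy hz ht
  have hx2 : 2 * (x * (1 - 2 * β)) = 3 * β := by
    have : (1 - 2 * β) * (2 * (x * (1 - 2 * β)) - 3 * β) = 0 := by
      field_simp at eq
      linear_combination eq
    exact sub_eq_zero.1 ((mul_eq_zero.1 this).resolve_left hβ2)
  have hx4 : 4 * x = 9 * β + 1 := by
    have : β * (4 * x - (9 * β + 1)) = 0 := by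
      linear_combination (-2) * ep + (1 - β) * hx2
    have := (mul_eq_zero.1 this).resolve_left hβ0
    linear_combination this
  refine ⟨by linear_combination (1 - 2 * β) * hx4 - 2 * hx2, hx4, hx2, ?_, rfl, rfl, rfl⟩
  have : β * (4 * s - (2 * x - 4 * x ^ 2 + 6 * β * x + β)) = 0 := by
    linear_combination (-4) * ea + (3 * β - 2 * β * x) * hx2
  linear_combination (mul_eq_zero.1 this).resolve_left hβ0

theorem linearIndependent_orbit {F V : Type*} [Field F] [AddCommGroup V] [Module F V]
    {a b c p q : V} {x : F} (h2 : (2 : F) ≠ 0)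
    (hind : LinearIndependent F ![a, p, q]) (hb : b = x • a + p + q) (hc : c = x • a + p - q) :
    LinearIndependent F ![c, a, b] := by
  rw [Fintype.linearIndependent_iff]
  intro d hd
  simp only [Fin.sum_univ_three, Matrix.cons_val_zero, Matrix.cons_val_one,
    Matrix.cons_val, hb, hc] at hd
  have e : (d 0 * x + d 1 + d 2 * x) • a + (d 0 + d 2) • p + (d 2 - d 0) • q = 0 := by
    linear_combination (norm := module) hd
  obtain ⟨ea, ep, eq⟩ := hind.coeff_eq_zero e
  have d2 : d 2 = 0 := (mul_eq_zero.1 (by linear_combination ep + eq : 2 * d 2 = 0)).resolve_left h2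
  have d0 : d 0 = 0 := by linear_combination ep - d2
  have d1 : d 1 = 0 := by linear_combination ea - x * d0 - x * d2
  intro i
  fin_cases i <;> assumption

end

/-- A symmetric 2-generated primitive axial algebra of Monster type `(2β, β)` of dimension
at most `3` is of Jordan type `β` or `2β`, or `18β² - β - 1 = 0` and it is isomorphic
to the algebra `V₃(β)`. -/
theorem stmt2 (F : Type*) [Field F] (V : Type*) [NonUnitalNonAssocCommRing V]
    [Module F V] [SMulCommClass F V V] [IsScalarTower F V V]
    (β : F) (hchar : (2 : F) ≠ 0) (hβ0 : β ≠ 0) (hβ1 : β ≠ 1) (hβhalf : β ≠ 1 / 2)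
    (a₀ a₁ : V) (ha₀ : IsAxis F (2 * β) β a₀) (ha₁ : IsAxis F (2 * β) β a₁)
    (hgen : NonUnitalAlgebra.adjoin F {a₀, a₁} = ⊤)
    (hsym : ∃ g : V ≃ₗ[F] V, IsAlgAut F g ∧ g a₀ = a₁ ∧ g a₁ = a₀)
    (hdim : Module.rank F V ≤ 3) :
    (eigSp F a₀ (2 * β) = ⊥ ∧ eigSp F a₁ (2 * β) = ⊥) ∨
      (eigSp F a₀ β = ⊥ ∧ eigSp F a₁ β = ⊥) ∨
      (18 * β ^ 2 - β - 1 = 0 ∧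
        ∃ bm b0 b1 : V,
          LinearIndependent F ![bm, b0, b1] ∧
          Submodule.span F {bm, b0, b1} = ⊤ ∧
          bm * bm = bm ∧ b0 * b0 = b0 ∧ b1 * b1 = b1 ∧
          bm * b0 = (3 * β / 2) • (bm + b0) + (β / 2) • b1 ∧
          bm * b1 = (3 * β / 2) • (bm + b1) + (β / 2) • b0 ∧
          b0 * b1 = (3 * β / 2) • (b0 + b1) + (β / 2) • bm) := by
  obtain ⟨g, hg, hg0, hg1⟩ := hsym
  by_cases hα : eigSp F a₀ (2 * β) = ⊥
  · exact Or.inl ⟨hα, hg.eigSp_eq_bot hg1 hα⟩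
  by_cases hβ : eigSp F a₀ β = ⊥
  · exact Or.inr (Or.inl ⟨hβ, hg.eigSp_eq_bot hg1 hβ⟩)
  refine Or.inr (Or.inr ?_)
  obtain ⟨u, hu, hu0⟩ := Submodule.exists_mem_ne_zero_of_ne_bot hα
  obtain ⟨v, hv, hv0⟩ := Submodule.exists_mem_ne_zero_of_ne_bot hβ
  rw [mem_eigSp] at hu hv
  have hβ2 : 1 - 2 * β ≠ 0 := by
    intro h
    apply hβhalf
    field_simp
    linear_combination -h
  have ha0 : a₀ ≠ 0 := by
    rintro rfl
    rw [zero_mul] at hv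
    exact smul_ne_zero hβ0 hv0 hv.symm
  have : Module.Finite F V :=
    Module.rank_lt_aleph0_iff.1 (hdim.trans_lt (by exact_mod_cast Cardinal.natCast_lt_aleph0 (n := 3)))
  have hfin : Module.finrank F V ≤ 3 := Module.finrank_le_of_rank_le (by exact_mod_cast hdim)
  have hind := linearIndependent_eigenvectors hβ0 hβ1 hβ2 ha0 hu0 hv0 ha₀.idem hu hv
  obtain ⟨x, k, l, hb⟩ := hind.exists_coeff hfin a₁
  obtain ⟨⟨s, huu⟩, -, y, z, hvv⟩ := ha₀.mul_eigenvectors hfin hchar hβ0 hβ1 hind hu hv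
  have hW : ∀ w : V, a₀ * w ∈ Submodule.span F {a₀, w} → w * w ∈ Submodule.span F {a₀, w} →
      a₁ ∈ Submodule.span F {a₀, w} → Submodule.span F {a₀, w} = ⊤ := by
    intro w h₁ h₂ h₃
    refine Submodule.eq_top_of_adjoin_eq_top hgen _ (span_pair_mul_mem ?_ h₁ h₂) ?_
    · rw [ha₀.idem]
      exact Submodule.mem_span_of_mem (by simp)
    · rintro _ (rfl | rfl)
      · exact Submodule.mem_span_of_mem (by simp)
      · exact h₃
  have hl : l ≠ 0 := by
    rintro rfl
    have hv' : v ∈ Submodule.span F {a₀, u} := by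
      rw [hW u]
      · exact Submodule.mem_top
      · exact Submodule.mem_span_pair.2 ⟨0, 2 * β, by rw [hu]; module⟩
      · exact Submodule.mem_span_pair.2 ⟨s, 0, by rw [huu]; module⟩
      · exact Submodule.mem_span_pair.2 ⟨x, k, by rw [hb]; module⟩
    obtain ⟨c, d, h⟩ := Submodule.mem_span_pair.1 hv'
    have e : c • a₀ + d • u + (-1 : F) • v = 0 := by
      linear_combination (norm := module) h
    exact neg_ne_zero.2 one_ne_zero (hind.coeff_eq_zero e).2.2
  have hk : k ≠ 0 := by
    rintro rfl
    have e₁ : (x * x + l * l * y - x) • a₀ + (l * l * z) • u + (2 * x * l * β - l) • v = 0 := by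
      have h := ha₁.idem
      rw [hb] at h
      simp only [zero_smul, add_zero, mul_add, add_mul, smul_mul_assoc, mul_smul_comm,
        ha₀.idem, hv, hvv, mul_comm v a₀] at h
      linear_combination (norm := module) h
    have hz : z = 0 := by simpa [hl] using (hind.coeff_eq_zero e₁).2.1
    have hu' : u ∈ Submodule.span F {a₀, v} := by
      rw [hW v]
      · exact Submodule.mem_top
      · exact Submodule.mem_span_pair.2 ⟨0, β, by rw [hv]; module⟩
      · exact Submodule.mem_span_pair.2 ⟨y, 0, by rw [hvv, hz]; module⟩
      · exact Submodule.mem_span_pair.2 ⟨x, l, by rw [hb]; module⟩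
    obtain ⟨c, d, h⟩ := Submodule.mem_span_pair.1 hu'
    have e : c • a₀ + (-1 : F) • u + d • v = 0 := by
      linear_combination (norm := module) h
    exact neg_ne_zero.2 one_ne_zero (hind.coeff_eq_zero e).2.1
  clear huu hvv s y z
  obtain ⟨p, hp⟩ : ∃ p, p = k • u := ⟨_, rfl⟩
  obtain ⟨q, hq⟩ : ∃ q, q = l • v := ⟨_, rfl⟩
  have hap : a₀ * p = (2 * β) • p := by rw [hp, mul_smul_comm, hu, smul_comm]
  have haq : a₀ * q = β • q := by rw [hq, mul_smul_comm, hv, smul_comm]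
  rw [← hp, ← hq] at hb
  have hind' := linearIndependent_eigenvectors hβ0 hβ1 hβ2 ha0 (hp ▸ smul_ne_zero hk hu0)
    (hq ▸ smul_ne_zero hl hv0) ha₀.idem hap haq
  obtain ⟨⟨s, hpp⟩, ⟨t, hpq⟩, y, z, hqq⟩ :=
    ha₀.mul_eigenvectors hfin hchar hβ0 hβ1 hind' hap haq
  have hgq : a₁ * g q = β • g q := by rw [← hg0, ← hg, haq, map_smul]
  have hgb : a₀ = x • a₁ + g p + g q := by
    have h := congrArg g hb
    rwa [map_add, map_add, map_smul, hg1, hg0] at h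
  have hgab : a₀ * a₁ = x • a₁ + (2 * β) • g p + β • g q := by
    have h := congrArg g (show a₀ * a₁ = x • a₀ + (2 * β) • p + β • q by
      rw [hb, mul_add, mul_add, mul_smul_comm, ha₀.idem, hap, haq])
    rw [hg, hg0, hg1, mul_comm a₁] at h
    simpa [hg0] using h
  obtain ⟨hmain, hx, hx', hs, rfl, rfl, rfl⟩ :=
    structure_constants hchar hβ0 hβ2 hind' ha₀.idem hap haq hpp hpq hqq hb ha₁.idem
      ⟨g q, hgq, by
        rw [hgab]
        linear_combination (norm := module) (-(2 * β)) • hgb⟩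
  obtain ⟨c, hc⟩ : ∃ c, c = x • a₀ + p - q := ⟨_, rfl⟩
  have hind₃ := linearIndependent_orbit hchar hind' hb hc
  refine ⟨hmain, c, a₀, a₁, hind₃, ?_, ?_, ha₀.idem, ha₁.idem, ?_, ?_, ?_⟩
  · rw [eq_top_iff]
    rintro w -
    obtain ⟨d, e, f, rfl⟩ := hind₃.exists_coeff hfin w
    exact Submodule.mem_span_triple.2 ⟨d, e, f, rfl⟩
  all_goals
    simp only [hc, hb, mul_add, add_mul, mul_sub, sub_mul, smul_mul_assoc, mul_smul_comm,
      ha₀.idem, hap, haq, hpp, hpq, hqq, mul_comm p a₀, mul_comm q a₀, mul_comm q p]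
    match_scalars
  all_goals try field_simp
  all_goals first
    | ring1
    | linear_combination hx'
    | linear_combination hs
    | linear_combination 4 * β * hx + 2 * hmain
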